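/- Let G be 3-edge-connected with DFS tree T rooted at r, and let u, v be vertices with v ≠ r, u a descendant of v, and B(u) = B(v) ⊔ {e} for a back-edge e = (x,y). Then M(v) ∈ {M(u), M̃(u), M_low1(u)}. In particular, either (1) M(v) = M(u) and e = (low_MD(u), low_M(u)), or (2) M(v) = M̃(u) and e = (M(u), l1(M(u))), or (3) M(v) = M_low1(u) and e = (M_low2(u), l1(M_low2(u))). -/

import Mathlib

/-- An undirected multigraph `G` (parallel edges allowed, no self-loops) together with a
DFS spanning tree `T` rooted at `root`, where the vertices are identified with their DFS
preorder numbers (so they are `Fin n`, and the root gets the smallest number).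
Tree edges are oriented from child to parent and back-edges from descendant to
(proper) ancestor. -/
structure DFSGraph where
  /-- number of vertices; the vertices are `Fin n`, numbered in DFS preorder -/
  n : ℕ
  /-- the type indexing the edges (parallel edges are allowed) -/
  Edge : Type
  edgeFintype : Fintype Edge
  /-- the first endpoint (the descendant end) of each edge -/
  fst : Edge → Fin n
  /-- the second endpoint (the ancestor end) of each edge -/
  snd : Edge → Fin n
  /-- no self-loops -/
  noloop : ∀ e, fst e ≠ snd e
  /-- the root `r` of the DFS tree -/
  root : Fin n
  /-- in DFS preorder the root gets the smallest number -/
  root_le : ∀ v, root ≤ v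
  /-- the parent function `p` of the DFS tree (arbitrary at the root) -/
  parent : Fin n → Fin n
  /-- the parent of a non-root vertex precedes it in preorder -/
  parent_lt : ∀ v, v ≠ root → parent v < v
  /-- `tEdge v` is the tree edge `(v, p(v))`, for `v ≠ root` -/
  tEdge : Fin n → Edge
  tEdge_fst : ∀ v, v ≠ root → fst (tEdge v) = v
  tEdge_snd : ∀ v, v ≠ root → snd (tEdge v) = parent v
  tEdge_inj : ∀ u v, u ≠ root → v ≠ root → tEdge u = tEdge v → u = v
  /-- DFS property: every non-tree edge is a back-edge, i.e. it joins a vertex to an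
  ancestor of it (a proper ancestor, by `noloop`) -/
  back_anc : ∀ e, (¬ ∃ v, v ≠ root ∧ e = tEdge v) →
    Relation.ReflTransGen (fun x y => x ≠ root ∧ y = parent x) (fst e) (snd e)
  /-- preorder property: the descendants of any vertex form an interval of preorder
  numbers starting at that vertex -/
  preorder_interval : ∀ v u w : Fin n, v ≤ u → u ≤ w →
    Relation.ReflTransGen (fun x y => x ≠ root ∧ y = parent x) w v →
    Relation.ReflTransGen (fun x y => x ≠ root ∧ y = parent x) u v

namespace DFSGraph

variable (G : DFSGraph)

/-- `Anc a b`: `a` is an ancestor of `b` in `T` (every vertex is an ancestor of itself). -/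
def Anc (a b : Fin G.n) : Prop :=
  Relation.ReflTransGen (fun x y => x ≠ G.root ∧ y = G.parent x) b a

/-- `PAnc a b`: `a` is a proper ancestor of `b` in `T`. -/
def PAnc (a b : Fin G.n) : Prop := G.Anc a b ∧ a ≠ b

/-- `e` is an edge of the spanning tree `T`. -/
def IsTreeEdge (e : G.Edge) : Prop := ∃ v, v ≠ G.root ∧ e = G.tEdge v

/-- `e` is a back-edge (an edge of `G ∖ T`). -/
def IsBack (e : G.Edge) : Prop := ¬ G.IsTreeEdge e

/-- `B v`: the set of back-edges `(x, y)` with `x` a descendant of `v` and `y` a proper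
ancestor of `v`. -/
def B (v : Fin G.n) : Set G.Edge :=
  {e | G.IsBack e ∧ G.Anc v (G.fst e) ∧ G.PAnc (G.snd e) v}

/-- `b_count(v) = |B(v)|`. -/
noncomputable def bcount (v : Fin G.n) : ℕ := (G.B v).ncard

/-- adjacency in `G` after removing the edge set `S` -/
def AdjOff (S : Set G.Edge) (x y : Fin G.n) : Prop :=
  ∃ e, e ∉ S ∧ ((G.fst e = x ∧ G.snd e = y) ∨ (G.fst e = y ∧ G.snd e = x))

/-- `G ∖ S` is connected -/
def ConnectedOff (S : Set G.Edge) : Prop :=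
  ∀ x y, Relation.ReflTransGen (G.AdjOff S) x y

/-- `S` is an edge cut of `G`: removing `S` disconnects `G`. -/
def IsCut (S : Set G.Edge) : Prop := ¬ G.ConnectedOff S

/-- `G` is `k`-edge-connected: it has no cut of fewer than `k` edges. -/
def EdgeConn (k : ℕ) : Prop := ∀ S : Set G.Edge, S.ncard < k → ¬ G.IsCut S

/-- `IsLow1 v y`: `y = low1(v) = min {y | ∃ (x,y) ∈ B(v)}`. -/
def IsLow1 (v y : Fin G.n) : Prop :=
  (∃ e ∈ G.B v, G.snd e = y) ∧ ∀ e ∈ G.B v, y ≤ G.snd e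

/-- `IsHigh v y`: `y = high(v) = max {y | ∃ (x,y) ∈ B(v)}`. -/
def IsHigh (v y : Fin G.n) : Prop :=
  (∃ e ∈ G.B v, G.snd e = y) ∧ ∀ e ∈ G.B v, G.snd e ≤ y

/-- `IsLow2 v y`: `y = low2(v)`, the minimum lower end of the back-edges in `B(v)` minus
one (fixed, but arbitrary) back-edge `(low1D(v), low1(v))` attaining `low1(v)`. -/
def IsLow2 (v y : Fin G.n) : Prop :=
  ∃ f ∈ G.B v, (∀ g ∈ G.B v, G.snd f ≤ G.snd g) ∧
    (∃ e ∈ G.B v, e ≠ f ∧ G.snd e = y) ∧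
    (∀ e ∈ G.B v, e ≠ f → y ≤ G.snd e)

/-- `IsL1 v y`: `y = l1(v) = min ({y | (v,y) is a back-edge} ∪ {v})`. -/
def IsL1 (v y : Fin G.n) : Prop :=
  (y = v ∨ ∃ e, G.IsBack e ∧ G.fst e = v ∧ G.snd e = y) ∧
  y ≤ v ∧ (∀ e, G.IsBack e → G.fst e = v → y ≤ G.snd e)

/-- `IsL2 v y`: `y = l2(v)`, defined as `l1(v)` but after removing one (fixed, but
arbitrary) back-edge `(v, l1(v))` attaining `l1(v)`, if such a back-edge exists. -/
def IsL2 (v y : Fin G.n) : Prop :=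
  ((¬ ∃ e, G.IsBack e ∧ G.fst e = v) ∧ y = v) ∨
  (∃ f, G.IsBack f ∧ G.fst f = v ∧
    (∀ g, G.IsBack g → G.fst g = v → G.snd f ≤ G.snd g) ∧
    (y = v ∨ ∃ e, G.IsBack e ∧ G.fst e = v ∧ e ≠ f ∧ G.snd e = y) ∧
    y ≤ v ∧
    (∀ e, G.IsBack e → G.fst e = v → e ≠ f → y ≤ G.snd e))

/-- `z` is the nearest common ancestor of the set of vertices `S`. -/
def IsNCA (S : Set (Fin G.n)) (z : Fin G.n) : Prop :=
  (∀ x ∈ S, G.Anc z x) ∧ ∀ z', (∀ x ∈ S, G.Anc z' x) → G.Anc z' z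

/-- `IsM v m`: `m = M(v)`, the nearest common ancestor of all higher ends of back-edges
in `B(v)`. -/
def IsM (v m : Fin G.n) : Prop :=
  G.IsNCA {x | ∃ e ∈ G.B v, G.fst e = x} m

/-- `IsMtilde v m`: `m = M̃(v)`, the nearest common ancestor of all higher ends of
back-edges in `B(v)` that are proper descendants of `M(v)` (defined only if such a
higher end exists). -/
def IsMtilde (v m : Fin G.n) : Prop :=
  ∃ mv, G.IsM v mv ∧
    {x | ∃ e ∈ G.B v, G.fst e = x ∧ G.PAnc mv x}.Nonempty ∧
    G.IsNCA {x | ∃ e ∈ G.B v, G.fst e = x ∧ G.PAnc mv x} m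

/-- `c` is a child of `p` in `T`. -/
def IsChild (p c : Fin G.n) : Prop := c ≠ G.root ∧ G.parent c = p

/-- `low1(c) ≤ low1(c')` (stated relationally). -/
def Low1LE (c c' : Fin G.n) : Prop :=
  ∀ y y', G.IsLow1 c y → G.IsLow1 c' y' → y ≤ y'

/-- `c = c₁(p)`: `c` is a `low1` child of `p`, i.e. a child of `p` minimizing `low1`. -/
def IsC1 (p c : Fin G.n) : Prop :=
  G.IsChild p c ∧ ∀ c', G.IsChild p c' → G.Low1LE c c'

/-- `c = c₂(p)`: `c` is a `low2` child of `p`, i.e. a child of `p` minimizing `low1`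
among the children different from the (fixed) `low1` child. -/
def IsC2 (p c : Fin G.n) : Prop :=
  ∃ c1, G.IsC1 p c1 ∧ G.IsChild p c ∧ c ≠ c1 ∧
    ∀ c', G.IsChild p c' → c' ≠ c1 → G.Low1LE c c'

/-- `c = c₃(p)`: `c` is a `low3` child of `p`. -/
def IsC3 (p c : Fin G.n) : Prop :=
  ∃ c1 c2, G.IsC1 p c1 ∧
    (G.IsChild p c2 ∧ c2 ≠ c1 ∧ ∀ c', G.IsChild p c' → c' ≠ c1 → G.Low1LE c2 c') ∧
    G.IsChild p c ∧ c ≠ c1 ∧ c ≠ c2 ∧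
    (∀ c', G.IsChild p c' → c' ≠ c1 → c' ≠ c2 → G.Low1LE c c')

/-- `IsMlow1 v m`: `m = M_low1(v)`, the nearest common ancestor of all higher ends of
back-edges in `B(v)` that are descendants of the `low1` child of `M(v)` (defined only
if such a higher end exists). -/
def IsMlow1 (v m : Fin G.n) : Prop :=
  ∃ mv c1, G.IsM v mv ∧ G.IsC1 mv c1 ∧
    {x | ∃ e ∈ G.B v, G.fst e = x ∧ G.Anc c1 x}.Nonempty ∧
    G.IsNCA {x | ∃ e ∈ G.B v, G.fst e = x ∧ G.Anc c1 x} m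

/-- `IsMlow2 v m`: `m = M_low2(v)`, the nearest common ancestor of all higher ends of
back-edges in `B(v)` that are descendants of the `low2` child of `M(v)` (defined only
if such a higher end exists). -/
def IsMlow2 (v m : Fin G.n) : Prop :=
  ∃ mv c2, G.IsM v mv ∧ G.IsC2 mv c2 ∧
    {x | ∃ e ∈ G.B v, G.fst e = x ∧ G.Anc c2 x}.Nonempty ∧
    G.IsNCA {x | ∃ e ∈ G.B v, G.fst e = x ∧ G.Anc c2 x} m

/-- `IsNextM v w`: `w = nextM(v)`, the maximum vertex `w < v` with `M(w) = M(v)`. -/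
def IsNextM (v w : Fin G.n) : Prop :=
  ∃ m, G.IsM v m ∧ G.IsM w m ∧ w < v ∧ ∀ w', w' < v → G.IsM w' m → w' ≤ w

/-- `IsLowM v l`: `l = low_M(v) = min {y | ∃ (x,y) ∈ B(v) ∖ B(nextM(v))}`. -/
def IsLowM (v l : Fin G.n) : Prop :=
  ∃ w, G.IsNextM v w ∧ (∃ e ∈ G.B v, e ∉ G.B w ∧ G.snd e = l) ∧
    ∀ e ∈ G.B v, e ∉ G.B w → l ≤ G.snd e

end DFSGraph
namespace DFSGraph

variable {G : DFSGraph}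

theorem Anc.le {a b : Fin G.n} (h : G.Anc a b) : a ≤ b := by
  unfold Anc at h
  induction h with
  | refl => exact le_rfl
  | tail _ h ih => exact h.2 ▸ (G.parent_lt _ h.1).le.trans ih

theorem Anc.refl (a : Fin G.n) : G.Anc a a := Relation.ReflTransGen.refl

theorem Anc.trans {a b c : Fin G.n} (h : G.Anc a b) (h' : G.Anc b c) : G.Anc a c :=
  Relation.ReflTransGen.trans h' h

/-- Descendants form an interval of the preorder. -/
theorem Anc.of_le {a b c : Fin G.n} (h : G.Anc a c) (hab : a ≤ b) (hbc : b ≤ c) : G.Anc a b :=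
  G.preorder_interval a b c hab hbc h

theorem Anc.total {a b c : Fin G.n} (h : G.Anc a c) (h' : G.Anc b c) :
    G.Anc a b ∨ G.Anc b a := by
  rcases le_total a b with hab | hab
  · exact .inl (h.of_le hab h'.le)
  · exact .inr (h'.of_le hab h.le)

theorem Anc.antisymm {a b : Fin G.n} (h : G.Anc a b) (h' : G.Anc b a) : a = b :=
  le_antisymm h.le h'.le

theorem anc_parent {a : Fin G.n} (h : a ≠ G.root) : G.Anc (G.parent a) a :=
  Relation.ReflTransGen.single ⟨h, rfl⟩

theorem PAnc.lt {a b : Fin G.n} (h : G.PAnc a b) : a < b := lt_of_le_of_ne h.1.le h.2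

theorem PAnc.anc_parent {a b : Fin G.n} (h : G.PAnc a b) : G.Anc a (G.parent b) := by
  rcases Relation.ReflTransGen.cases_head h.1 with h' | ⟨c, hc, h'⟩
  · exact absurd h'.symm h.2
  · exact hc.2 ▸ h'

theorem PAnc.exists_child {a b : Fin G.n} (h : G.PAnc a b) :
    ∃ c, G.IsChild a c ∧ G.Anc c b := by
  rcases Relation.ReflTransGen.cases_tail h.1 with h' | ⟨c, hc, h'⟩
  · exact absurd h' h.2
  · exact ⟨c, ⟨h'.1, h'.2.symm⟩, hc⟩

theorem IsChild.lt {p c : Fin G.n} (h : G.IsChild p c) : p < c := h.2 ▸ G.parent_lt c h.1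

theorem IsChild.anc {p c : Fin G.n} (h : G.IsChild p c) : G.Anc p c := h.2 ▸ anc_parent h.1

/-- The subtrees of distinct siblings are disjoint. -/
theorem IsChild.eq_of_anc {p c d z : Fin G.n} (hc : G.IsChild p c) (hd : G.IsChild p d)
    (hcz : G.Anc c z) (hdz : G.Anc d z) : c = d := by
  have key : ∀ {c d : Fin G.n}, G.IsChild p c → G.IsChild p d → G.Anc c d → c = d := by
    intro c d hc hd h
    by_contra hne
    have : G.Anc c p := hd.2 ▸ PAnc.anc_parent ⟨h, hne⟩
    exact absurd this.le (not_le.2 hc.lt)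
  rcases hcz.total hdz with h | h
  · exact key hc hd h
  · exact (key hd hc h).symm

theorem anc_root (x : Fin G.n) : G.Anc G.root x := by
  induction x using WellFoundedLT.induction with
  | _ x ih =>
    by_cases h : x = G.root
    · exact h ▸ Anc.refl _
    · exact (ih _ (G.parent_lt x h)).trans (anc_parent h)

theorem exists_isNCA {S : Set (Fin G.n)} (hS : S.Nonempty) : ∃ z, G.IsNCA S z := by
  obtain ⟨s, hs⟩ := hS
  obtain ⟨z, hz, hmax⟩ := (Set.toFinite {z | ∀ x ∈ S, G.Anc z x}).exists_maximal
    ⟨G.root, fun x _ => anc_root x⟩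
  refine ⟨z, hz, fun z' hz' => ?_⟩
  rcases (hz s hs).total (hz' s hs) with h | h
  · exact le_antisymm h.le (hmax hz' h.le) ▸ Anc.refl _
  · exact h

theorem IsBack.anc {e : G.Edge} (h : G.IsBack e) : G.Anc (G.snd e) (G.fst e) :=
  G.back_anc e h

theorem anc_snd_fst (e : G.Edge) : G.Anc (G.snd e) (G.fst e) := by
  by_cases h : G.IsTreeEdge e
  · obtain ⟨w, hw, rfl⟩ := h
    rw [G.tEdge_fst w hw, G.tEdge_snd w hw]
    exact anc_parent hw
  · exact IsBack.anc h

/-- The edges leaving the subtree of `u` are the tree edge of `u` and the edges of `B u`. -/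
theorem anc_snd_of_anc_fst {u : Fin G.n} {e : G.Edge} (ht : e ≠ G.tEdge u) (hB : e ∉ G.B u)
    (h : G.Anc u (G.fst e)) : G.Anc u (G.snd e) := by
  by_cases hb : G.IsTreeEdge e
  · obtain ⟨w, hw, rfl⟩ := hb
    rw [G.tEdge_fst w hw] at h
    rw [G.tEdge_snd w hw]
    exact PAnc.anc_parent ⟨h, fun huw => ht (huw ▸ rfl)⟩
  · rcases h.total (anc_snd_fst e) with h' | h'
    · exact h'
    · by_contra hn
      exact hB ⟨hb, h, h', fun heq => hn (heq ▸ Anc.refl _)⟩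

theorem isCut_of_separates {S : Set G.Edge} (P : Fin G.n → Prop)
    (hP : ∀ e, e ∉ S → (P (G.fst e) ↔ P (G.snd e))) {a b : Fin G.n} (ha : P a) (hb : ¬ P b) :
    G.IsCut S := by
  intro hconn
  apply hb
  have := hconn a b
  clear hb
  induction this with
  | refl => exact ha
  | tail _ h ih =>
    obtain ⟨e, he, ⟨rfl, rfl⟩ | ⟨rfl, rfl⟩⟩ := h
    · exact (hP e he).1 ih
    · exact (hP e he).2 ih

theorem EdgeConn.nonempty_B (h : G.EdgeConn 3) {v : Fin G.n} (hv : v ≠ G.root) :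
    (G.B v).Nonempty := by
  by_contra hB
  rw [Set.not_nonempty_iff_eq_empty] at hB
  refine h {G.tEdge v} (by simp) (isCut_of_separates (G.Anc v) ?_ (Anc.refl v)
    (b := G.root) fun hr => hv (hr.antisymm (anc_root v)))
  exact fun e he => ⟨anc_snd_of_anc_fst he (by simp [hB]), fun h' => h'.trans (anc_snd_fst e)⟩

theorem EdgeConn.B_ne (h : G.EdgeConn 3) {u w : Fin G.n} (hwu : G.PAnc w u) :
    G.B u ≠ G.B w := by
  intro hB
  refine h {G.tEdge u, G.tEdge w} ((Set.ncard_insert_le _ _).trans_lt (by simp))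
    (isCut_of_separates (fun z => G.Anc w z ∧ ¬ G.Anc u z) (fun e he => ?_)
      (a := w) (b := u) ⟨Anc.refl w, fun h' => hwu.2 (hwu.1.antisymm h')⟩
      fun h' => h'.2 (Anc.refl u))
  simp only [Set.mem_insert_iff, Set.mem_singleton_iff, not_or] at he
  have up (z : Fin G.n) (h' : G.Anc z (G.snd e)) : G.Anc z (G.fst e) := h'.trans (anc_snd_fst e)
  by_cases heB : e ∈ G.B u
  · have heB' : e ∈ G.B w := hB ▸ heB
    exact ⟨fun h' => absurd heB.2.1 h'.2,
      fun h' => absurd (heB'.2.2.1.antisymm h'.1) heB'.2.2.2⟩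
  · have hu := anc_snd_of_anc_fst he.1 heB
    have hw := anc_snd_of_anc_fst he.2 (hB ▸ heB)
    exact ⟨fun h' => ⟨hw h'.1, fun h'' => h'.2 (up u h'')⟩,
      fun h' => ⟨up w h'.1, fun h'' => h'.2 (hu h'')⟩⟩

theorem mem_B_of_lt {u : Fin G.n} {e : G.Edge} (he : G.IsBack e) (hu : G.Anc u (G.fst e))
    (hlt : G.snd e < u) : e ∈ G.B u :=
  ⟨he, hu, he.anc.of_le hlt.le hu.le, hlt.ne⟩

end DFSGraph

open DFSGraph

/-- Lemma 3.3: Let `G` be `3`-edge-connected with DFS tree `T` rooted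
at `r`, and let `u, v` be vertices with `v ≠ r`, `u` a descendant of `v`, and
`B(u) = B(v) ⊔ {e}` for a back-edge `e = (x,y)`. Then
`M(v) ∈ {M(u), M̃(u), M_low1(u)}`; in particular, either
(1) `M(v) = M(u)` and `e = (low_MD(u), low_M(u))`, or
(2) `M(v) = M̃(u)` and `e = (M(u), l1(M(u)))`, or
(3) `M(v) = M_low1(u)` and `e = (M_low2(u), l1(M_low2(u)))`. -/
theorem stmt7 (G : DFSGraph) (h3 : G.EdgeConn 3) (u v : Fin G.n)
    (hv : v ≠ G.root) (hanc : G.Anc v u) (e : G.Edge)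
    (he : G.IsBack e) (hev : e ∉ G.B v) (hB : G.B u = insert e (G.B v)) :
    ∃ mv, G.IsM v mv ∧
      ((G.IsM u mv ∧ ∃ l, G.IsLowM u l ∧ G.snd e = l) ∨
       (G.IsMtilde u mv ∧ ∃ mu, G.IsM u mu ∧ G.fst e = mu ∧ G.IsL1 mu (G.snd e)) ∨
       (G.IsMlow1 u mv ∧ ∃ m2, G.IsMlow2 u m2 ∧ G.fst e = m2 ∧ G.IsL1 m2 (G.snd e))) := by
  obtain ⟨mv, hmv⟩ : ∃ m, G.IsM v m :=
    exists_isNCA ((h3.nonempty_B hv).image G.fst)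
  have heu : e ∈ G.B u := hB ▸ Set.mem_insert e _
  obtain ⟨mu, hmu⟩ : ∃ m, G.IsM u m := exists_isNCA ⟨_, e, heu, rfl⟩
  have hsub : ∀ f ∈ G.B v, f ∈ G.B u := fun f hf => hB ▸ Set.mem_insert_of_mem e hf
  have hmem : ∀ f ∈ G.B u, f = e ∨ f ∈ G.B v := fun f hf => by
    rwa [hB] at hf
  have hmv_fst : ∀ f ∈ G.B v, G.Anc mv (G.fst f) := fun f hf => hmv.1 _ ⟨f, hf, rfl⟩
  have hmu_fst : ∀ f ∈ G.B u, G.Anc mu (G.fst f) := fun f hf => hmu.1 _ ⟨f, hf, rfl⟩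
  have humu : G.Anc u mu := hmu.2 u fun x ⟨f, hf, hx⟩ => hx ▸ hf.2.1
  have hmumv : G.Anc mu mv := hmv.2 mu fun x ⟨f, hf, hx⟩ => hx ▸ hmu_fst f (hsub f hf)
  obtain ⟨g, hg⟩ := h3.nonempty_B hv
  have hve : v ≤ G.snd e := by
    by_contra! hlt
    exact hev (mem_B_of_lt he (hanc.trans heu.2.1) hlt)
  have hl1 : ¬ G.Anc mv (G.fst e) → G.IsL1 (G.fst e) (G.snd e) := by
    refine fun hn => ⟨.inr ⟨e, he, rfl, rfl⟩, he.anc.le, fun f hf hfe => ?_⟩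
    by_contra! hlt
    rcases hmem f (mem_B_of_lt hf (hfe ▸ heu.2.1) (hlt.trans heu.2.2.lt)) with rfl | hfv
    · exact lt_irrefl _ hlt
    · exact hn (hfe ▸ hmv_fst f hfv)
  refine ⟨mv, hmv, ?_⟩
  by_cases hmm : mu = mv
  · subst hmm
    refine .inl ⟨hmu, G.snd e, ?_, rfl⟩
    have hvu : v < u := hve.trans_lt heu.2.2.lt
    obtain ⟨w, ⟨hwu, hwM⟩, hmax⟩ :=
      (Set.toFinite {w | w < u ∧ G.IsM w mu}).exists_maximal ⟨v, hvu, hmv⟩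
    have hle : ∀ w', w' < u → G.IsM w' mu → w' ≤ w := fun w' h1 h2 => by
      rcases le_total w' w with h | h
      · exact h
      · exact hmax ⟨h1, h2⟩ h
    have hvw : v ≤ w := hle v hvu hmv
    have hwmu : G.Anc w mu := hwM.2 w fun x ⟨f, hf, hx⟩ => hx ▸ hf.2.1
    have hwanc : G.Anc w u := hwmu.of_le hwu.le humu.le
    have hvB : ∀ f ∈ G.B v, f ∈ G.B w := fun f hf =>
      mem_B_of_lt hf.1 (hwanc.trans (hsub f hf).2.1) (hf.2.2.lt.trans_le hvw)
    have hwB : ∀ f ∈ G.B w, f ∈ G.B u := fun f hf =>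
      mem_B_of_lt hf.1 (humu.trans (hwM.1 _ ⟨f, hf, rfl⟩)) (hf.2.2.lt.trans hwu)
    have hew : e ∉ G.B w := fun hew => h3.B_ne ⟨hwanc, hwu.ne⟩ <|
      Set.Subset.antisymm (fun f hf => (hmem f hf).elim (fun h => h ▸ hew) (hvB f)) hwB
    refine ⟨w, ⟨mu, hmu, hwM, hwu, hle⟩, ⟨e, heu, hew, rfl⟩, fun f hf hfw => ?_⟩
    rcases hmem f hf with rfl | hfv
    · exact le_rfl
    · exact absurd (hvB f hfv) hfw
  have hne : ¬ G.Anc mv (G.fst e) := fun h => hmm <| hmumv.antisymm <|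
    hmu.2 mv fun x ⟨f, hf, hx⟩ => hx ▸ (hmem f hf).elim (fun h' => h' ▸ h) (hmv_fst f)
  right
  by_cases hx : mu = G.fst e
  · left
    have hset : {x | ∃ f ∈ G.B u, G.fst f = x ∧ G.PAnc mu x} = {x | ∃ f ∈ G.B v, G.fst f = x} := by
      ext x
      constructor
      · rintro ⟨f, hf, rfl, hp⟩
        rcases hmem f hf with rfl | hfv
        · exact absurd hx hp.2
        · exact ⟨f, hfv, rfl⟩
      · rintro ⟨f, hf, rfl⟩
        exact ⟨f, hsub f hf, rfl, hmu_fst f (hsub f hf),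
          fun h => hmm (hmumv.antisymm (h ▸ hmv_fst f hf))⟩
    refine ⟨⟨mu, hmu, ?_, ?_⟩, mu, hmu, hx.symm, hx ▸ hl1 hne⟩
    · exact hset ▸ ⟨_, g, hg, rfl⟩
    · exact hset ▸ hmv
  right
  obtain ⟨c, hc, hcmv⟩ := PAnc.exists_child ⟨hmumv, hmm⟩
  obtain ⟨d, hd, hde⟩ := PAnc.exists_child ⟨hmu_fst e heu, hx⟩
  have hce : ¬ G.Anc c (G.fst e) := fun h => absurd
    (hmu.2 c fun x ⟨f, hf, hx⟩ => hx ▸ (hmem f hf).elim (fun h' => h' ▸ h)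
      fun hfv => hcmv.trans (hmv_fst f hfv)).le (not_le.2 hc.lt)
  have hdc : d ≠ c := fun h => hce (h ▸ hde)
  have hdB : e ∈ G.B d := mem_B_of_lt he hde
    (heu.2.2.lt.trans_le (humu.le.trans hd.lt.le))
  have hcB : ∀ f ∈ G.B v, f ∈ G.B c := fun f hf =>
    mem_B_of_lt hf.1 (hcmv.trans (hmv_fst f hf))
      ((hsub f hf).2.2.lt.trans_le (humu.le.trans hc.lt.le))
  have hchild : ∀ c', G.IsChild mu c' → ∀ f ∈ G.B c', G.snd f < u → f ∈ G.B u :=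
    fun c' hc' f hf hlt => mem_B_of_lt hf.1 (humu.trans (hc'.anc.trans hf.2.1)) hlt
  have hC1 : G.IsC1 mu c := by
    refine ⟨hc, fun c' hc' y y' hy hy' => ?_⟩
    by_contra! hlt
    obtain ⟨f, hf, rfl⟩ := hy'.1
    have hfv : G.snd f < v := (hlt.trans_le (hy.2 g (hcB g hg))).trans hg.2.2.lt
    rcases hmem f (hchild c' hc' f hf (hfv.trans_le hanc.le)) with rfl | hfB
    · exact absurd hfv (not_lt.2 hve)
    · exact absurd (hy.2 f (hcB f hfB)) (not_le.2 hlt)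
  have hC2 : G.IsC2 mu d := by
    refine ⟨c, hC1, hd, hdc, fun c' hc' hne' y y' hy hy' => ?_⟩
    by_contra! hlt
    obtain ⟨f, hf, rfl⟩ := hy'.1
    have hfe : G.snd f < G.snd e := hlt.trans_le (hy.2 e hdB)
    rcases hmem f (hchild c' hc' f hf (hfe.trans heu.2.2.lt)) with rfl | hfv
    · exact lt_irrefl _ hfe
    · exact hne' (hc'.eq_of_anc hc hf.2.1 (hcB f hfv).2.1)
  have hset1 : {x | ∃ f ∈ G.B u, G.fst f = x ∧ G.Anc c x} = {x | ∃ f ∈ G.B v, G.fst f = x} := by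
    ext x
    constructor
    · rintro ⟨f, hf, rfl, hp⟩
      rcases hmem f hf with rfl | hfv
      · exact absurd hp hce
      · exact ⟨f, hfv, rfl⟩
    · rintro ⟨f, hf, rfl⟩
      exact ⟨f, hsub f hf, rfl, (hcB f hf).2.1⟩
  refine ⟨⟨mu, c, hmu, hC1, hset1 ▸ ⟨_, g, hg, rfl⟩, hset1 ▸ hmv⟩,
    G.fst e, ⟨mu, d, hmu, hC2, ⟨_, e, heu, rfl, hde⟩, ?_, ?_⟩, rfl, hl1 hne⟩
  · rintro x ⟨f, hf, rfl, hp⟩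
    rcases hmem f hf with rfl | hfv
    · exact Anc.refl _
    · exact absurd (hd.eq_of_anc hc hp (hcB f hfv).2.1) hdc
  · exact fun z hz => hz _ ⟨e, heu, rfl, hde⟩
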